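/- Let r̂ : [T₋,T₊] → ℝ³ be a trajectory with v̂ = ∂_t r̂, let R_n → 0, and let ρ_n : Ω̂_n → ℝ and J_n : Ω̂_n → ℝ³ be C¹ functions on the tubes Ω̂_n = {(t,x) : T₋ ≤ t ≤ T₊, |x − r̂(t)| ≤ R_n} satisfying the continuity equation ∂_tρ_n + ∇·J_n = 0. Set ρ̄_n(t) = ∫_{B(r̂(t),R_n)} ρ_n dx. Assume that for some t₀ ∈ [T₋,T₊] the boundary terms Q₂₃(t) = ∫_{t₀}^{t} ∫_{∂B(r̂(t′),R_n)} (ρ_n v̂·n̄ − n̄·J_n) dσ dt′ tend to 0 uniformly in t ∈ [T₋,T₊], where n̄ is the outward unit normal and σ the 2-dimensional surface measure on the sphere, and that ρ̄_n(t₀) → ρ̄_∞. Then ρ̄_n(t) → ρ̄_∞ uniformly on [T₋,T₊]. -/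

import Mathlib

noncomputable section

open MeasureTheory Complex Filter Topology Metric

/-- Physical space `ℝ³` with the Euclidean metric. -/
abbrev V3 : Type := EuclideanSpace ℝ (Fin 3)

/-- Dot product of two triples of reals. -/
def dot3 (v w : Fin 3 → ℝ) : ℝ := ∑ i, v i * w i

/-- Cross product in `ℝ³`. -/
def cross3 (v w : Fin 3 → ℝ) : Fin 3 → ℝ :=
  ![v 1 * w 2 - v 2 * w 1, v 2 * w 0 - v 0 * w 2, v 0 * w 1 - v 1 * w 0]

/-- Matrix (as nested function) applied to a vector. -/
def matVec (M : Fin 3 → Fin 3 → ℝ) (v : Fin 3 → ℝ) : Fin 3 → ℝ := fun j => ∑ i, M j i * v i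

/-- Partial derivative in time of a function of `(t, x)`. -/
def ptD {F : Type} [NormedAddCommGroup F] [NormedSpace ℝ F]
    (f : ℝ × V3 → F) (p : ℝ × V3) : F := fderiv ℝ f p (1, 0)

/-- Partial derivative in the `i`-th spatial direction of a function of `(t, x)`. -/
def pxD {F : Type} [NormedAddCommGroup F] [NormedSpace ℝ F]
    (i : Fin 3) (f : ℝ × V3 → F) (p : ℝ × V3) : F :=
  fderiv ℝ f p (0, EuclideanSpace.single i 1)

/-- Partial derivative in the `i`-th direction of a function on space only. -/
def pxS {F : Type} [NormedAddCommGroup F] [NormedSpace ℝ F]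
    (i : Fin 3) (f : V3 → F) (x : V3) : F :=
  fderiv ℝ f x (EuclideanSpace.single i 1)

/-- Laplacian of a scalar function on `ℝ³`. -/
def lap3 (f : V3 → ℝ) (x : V3) : ℝ := ∑ i, pxS i (pxS i f) x

/-- Covariant time derivative `∂̃_t = ∂_t + i (q/χ) φ`. -/
def covT (χ q : ℝ) (φ : ℝ × V3 → ℝ) (ψ : ℝ × V3 → ℂ) (p : ℝ × V3) : ℂ :=
  ptD ψ p + Complex.I * ((q / χ : ℝ) : ℂ) * ((φ p : ℝ) : ℂ) * ψ p

/-- Covariant spatial derivative `∂̃_i = ∂_i − i (q/(χc)) A_i`. -/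
def covX (χ q c : ℝ) (A : ℝ × V3 → Fin 3 → ℝ) (i : Fin 3)
    (ψ : ℝ × V3 → ℂ) (p : ℝ × V3) : ℂ :=
  pxD i ψ p - Complex.I * ((q / (χ * c) : ℝ) : ℂ) * ((A p i : ℝ) : ℂ) * ψ p

/-- The NLS equation `i ∂̃_t ψ = (χ/(2m)) ( −∇̃²ψ + G'_a(|ψ|²) ψ )` at a point,
with the scaled nonlinearity `G'_a(s) = a⁻² G'₁(a³ s)`. -/
def SatisfiesNLS (χ m q c a : ℝ) (G1' : ℝ → ℝ) (φ : ℝ × V3 → ℝ)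
    (A : ℝ × V3 → Fin 3 → ℝ) (ψ : ℝ × V3 → ℂ) (p : ℝ × V3) : Prop :=
  Complex.I * covT χ q φ ψ p =
    ((χ / (2 * m) : ℝ) : ℂ) *
      (-(∑ i, covX χ q c A i (covX χ q c A i ψ) p) +
        (((a ^ (2 : ℕ))⁻¹ * G1' (a ^ (3 : ℕ) * Complex.normSq (ψ p)) : ℝ) : ℂ) * ψ p)

/-- The NLS equation with an unscaled nonlinearity `G'`. -/
def SatisfiesNLS' (χ m q c : ℝ) (G' : ℝ → ℝ) (φ : ℝ × V3 → ℝ)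
    (A : ℝ × V3 → Fin 3 → ℝ) (ψ : ℝ × V3 → ℂ) (p : ℝ × V3) : Prop :=
  Complex.I * covT χ q φ ψ p =
    ((χ / (2 * m) : ℝ) : ℂ) *
      (-(∑ i, covX χ q c A i (covX χ q c A i ψ) p) +
        ((G' (Complex.normSq (ψ p)) : ℝ) : ℂ) * ψ p)

/-- Charge density `ρ = q |ψ|²`. -/
def rhoD (q : ℝ) (ψ : ℝ × V3 → ℂ) (p : ℝ × V3) : ℝ := q * Complex.normSq (ψ p)

/-- Current density `J = −i (qχ/(2m)) (ψ* ∇̃ψ − ψ (∇̃ψ)*)`. -/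
def JD (χ m q c : ℝ) (A : ℝ × V3 → Fin 3 → ℝ) (ψ : ℝ × V3 → ℂ)
    (p : ℝ × V3) : Fin 3 → ℝ := fun i =>
  (-Complex.I * ((q * χ / (2 * m) : ℝ) : ℂ) *
    ((starRingEnd ℂ) (ψ p) * covX χ q c A i ψ p
      - ψ p * (starRingEnd ℂ) (covX χ q c A i ψ p))).re

/-- Momentum density `P = (iχ/2) (ψ (∇̃ψ)* − ψ* ∇̃ψ)`. -/
def PD (χ q c : ℝ) (A : ℝ × V3 → Fin 3 → ℝ) (ψ : ℝ × V3 → ℂ)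
    (p : ℝ × V3) : Fin 3 → ℝ := fun i =>
  (Complex.I * ((χ / 2 : ℝ) : ℂ) *
    (ψ p * (starRingEnd ℂ) (covX χ q c A i ψ p)
      - (starRingEnd ℂ) (ψ p) * covX χ q c A i ψ p)).re

/-- Energy density `u = (χ²/(2m)) ( |∇̃ψ|² + G_a(|ψ|²) )` for an antiderivative `Ga`. -/
def uD (χ m q c : ℝ) (Ga : ℝ → ℝ) (A : ℝ × V3 → Fin 3 → ℝ) (ψ : ℝ × V3 → ℂ)
    (p : ℝ × V3) : ℝ :=
  (χ ^ 2 / (2 * m)) * ((∑ i, Complex.normSq (covX χ q c A i ψ p)) + Ga (Complex.normSq (ψ p)))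

/-- Entries `T^{ij}` of the energy–momentum (stress) tensor of the NLS. -/
def TD (χ m q c : ℝ) (Ga : ℝ → ℝ) (φ : ℝ × V3 → ℝ) (A : ℝ × V3 → Fin 3 → ℝ)
    (ψ : ℝ × V3 → ℂ) (i j : Fin 3) (p : ℝ × V3) : ℝ :=
  if i = j then
    uD χ m q c Ga A ψ p - (χ ^ 2 / m) * Complex.normSq (covX χ q c A i ψ p)
      + (Complex.I * ((χ / 2 : ℝ) : ℂ) *
          (ψ p * (starRingEnd ℂ) (covT χ q φ ψ p)
            - (starRingEnd ℂ) (ψ p) * covT χ q φ ψ p)).re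
  else
    (-(((χ ^ 2 / (2 * m) : ℝ)) : ℂ) *
        (covX χ q c A i ψ p * (starRingEnd ℂ) (covX χ q c A j ψ p)
          + covX χ q c A j ψ p * (starRingEnd ℂ) (covX χ q c A i ψ p))).re

/-- Electric field `E = −∇φ − (1/c) ∂_t A`. -/
def ED (c : ℝ) (φ : ℝ × V3 → ℝ) (A : ℝ × V3 → Fin 3 → ℝ) (p : ℝ × V3) : Fin 3 → ℝ :=
  fun i => -(pxD i φ p) - (1 / c) * ptD A p i

/-- Magnetic field `B = ∇ × A`. -/
def BD (A : ℝ × V3 → Fin 3 → ℝ) (p : ℝ × V3) : Fin 3 → ℝ :=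
  ![pxD 1 A p 2 - pxD 2 A p 1, pxD 2 A p 0 - pxD 0 A p 2, pxD 0 A p 1 - pxD 1 A p 0]

/-- Lorentz force density `f = ρ E + (1/c) J × B`. -/
def fD (χ m q c : ℝ) (φ : ℝ × V3 → ℝ) (A : ℝ × V3 → Fin 3 → ℝ) (ψ : ℝ × V3 → ℂ)
    (p : ℝ × V3) : Fin 3 → ℝ := fun j =>
  rhoD q ψ p * ED c φ A p j + (1 / c) * cross3 (JD χ m q c A ψ p) (BD A p) j

/-- A tubular neighborhood `Ω̂` of a trajectory. -/
def Tube (Tm Tp : ℝ) (r : ℝ → V3) (R : ℝ) : Set (ℝ × V3) :=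
  {p | p.1 ∈ Set.Icc Tm Tp ∧ ‖p.2 - r p.1‖ ≤ R}

/-- Outward unit normal on the sphere of radius `R` centered at `ctr`. -/
def nrm (ctr : V3) (R : ℝ) (x : V3) : Fin 3 → ℝ := fun i => (x i - ctr i) / R

/-- A trajectory: a `C²` curve with bounded first and second derivatives on `[T₋, T₊]`. -/
def IsTrajectory (Tm Tp : ℝ) (r : ℝ → V3) : Prop :=
  ContDiff ℝ 2 r ∧ ∃ C : ℝ, ∀ t ∈ Set.Icc Tm Tp, ‖deriv r t‖ ≤ C ∧ ‖deriv (deriv r) t‖ ≤ C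

/-- Adjacent (restricted) charge value `ρ̄_n(t)`. -/
def rbar (q : ℝ) (rhat : ℝ → V3) (R : ℕ → ℝ) (ψ : ℕ → ℝ × V3 → ℂ) (n : ℕ) (t : ℝ) : ℝ :=
  ∫ x in closedBall (rhat t) (R n), rhoD q (ψ n) (t, x)

/-- Adjacent charge center `r_n(t)`. -/
def rcen (q : ℝ) (rhat : ℝ → V3) (R : ℕ → ℝ) (ψ : ℕ → ℝ × V3 → ℂ) (n : ℕ) (t : ℝ) : V3 :=
  (rbar q rhat R ψ n t)⁻¹ • ∫ x in closedBall (rhat t) (R n), rhoD q (ψ n) (t, x) • x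

/-- Velocity of the adjacent charge center. -/
def vcen (Tm Tp q : ℝ) (rhat : ℝ → V3) (R : ℕ → ℝ) (ψ : ℕ → ℝ × V3 → ℂ)
    (n : ℕ) (t : ℝ) : V3 :=
  derivWithin (rcen q rhat R ψ n) (Set.Icc Tm Tp) t

end

noncomputable section
open MeasureTheory Complex Filter Topology Metric

lemma unif_unique {S : Type*} [MetricSpace S] [CompactSpace S] [MeasurableSpace S] [BorelSpace S]
    (μ ν : Measure S) [IsFiniteMeasure μ] [IsFiniteMeasure ν]
    (h k : ℝ → ℝ) (hμ : ∀ r x, μ.real (ball x r) = h r) (hν : ∀ r x, ν.real (ball x r) = k r)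
    (hk : ∀ r, 0 < r → 0 < k r) (f : S → ℝ) (hf : Continuous f) :
    ν.real Set.univ * ∫ x, f x ∂μ = μ.real Set.univ * ∫ x, f x ∂ν := by
  set a := μ.real Set.univ with ha
  set b := ν.real Set.univ with hb
  have ha0 : 0 ≤ a := measureReal_nonneg
  have hb0 : 0 ≤ b := measureReal_nonneg
  obtain ⟨C, hC⟩ := isCompact_univ.exists_bound_of_continuousOn hf.continuousOn
  have key : ∀ ε > 0, |b * ∫ x, f x ∂μ - a * ∫ x, f x ∂ν| ≤ ε * (a * b) := by
    intro ε hε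
    obtain ⟨r, hr, hfr⟩ := Metric.uniformContinuous_iff.1
      (CompactSpace.uniformContinuous_of_continuous hf) ε hε
    set D : Set (S × S) := {p | dist p.1 p.2 < r} with hD
    have hDm : MeasurableSet D := (isOpen_lt (by fun_prop) continuous_const).measurableSet
    have int1 : Integrable (fun p : S × S => D.indicator (fun p => f p.1) p) (μ.prod ν) := by
      refine Integrable.indicator ?_ hDm
      exact Integrable.of_bound (by fun_prop : Continuous fun p : S × S => f p.1).aestronglyMeasurable C
        (Eventually.of_forall fun p => hC _ (Set.mem_univ _))
    have int2 : Integrable (fun p : S × S => D.indicator (fun p => f p.2) p) (μ.prod ν) := by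
      refine Integrable.indicator ?_ hDm
      exact Integrable.of_bound (by fun_prop : Continuous fun p : S × S => f p.2).aestronglyMeasurable C
        (Eventually.of_forall fun p => hC _ (Set.mem_univ _))
    have e1 : ∫ p, D.indicator (fun p => f p.1) p ∂(μ.prod ν) = k r * ∫ x, f x ∂μ := by
      rw [integral_prod _ int1, ← integral_const_mul]
      congr 1; ext x
      have : (fun y => D.indicator (fun p : S × S => f p.1) (x, y))
          = (ball x r).indicator (fun _ => f x) := by
        ext y; simp [Set.indicator, hD, dist_comm x y]
      rw [this, integral_indicator measurableSet_ball, setIntegral_const, hν, smul_eq_mul]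
    have e2 : ∫ p, D.indicator (fun p => f p.2) p ∂(μ.prod ν) = h r * ∫ x, f x ∂ν := by
      rw [integral_prod_symm _ int2, ← integral_const_mul]
      congr 1; ext y
      have : (fun x => D.indicator (fun p : S × S => f p.2) (x, y))
          = (ball y r).indicator (fun _ => f y) := by
        ext y; simp [Set.indicator, hD]
      rw [this, integral_indicator measurableSet_ball, setIntegral_const, hμ, smul_eq_mul]
    have intc : Integrable (fun p : S × S => D.indicator (fun _ => (1:ℝ)) p) (μ.prod ν) :=
      (integrable_const _).indicator hDm
    have e3 : ∫ p, D.indicator (fun _ => (1:ℝ)) p ∂(μ.prod ν) = k r * a := by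
      rw [integral_prod _ intc]
      have : ∀ x, ∫ y, D.indicator (fun _ => (1:ℝ)) (x, y) ∂ν = k r := by
        intro x
        have : (fun y => D.indicator (fun _ : S × S => (1:ℝ)) (x, y))
          = (ball x r).indicator (fun _ => 1) := by
          ext y; simp [Set.indicator, hD, dist_comm x y]
        rw [this, integral_indicator measurableSet_ball, setIntegral_const, hν, smul_eq_mul, mul_one]
      simp only [this, integral_const, smul_eq_mul]
      rw [← ha]; ring
    have e4 : ∫ p, D.indicator (fun _ => (1:ℝ)) p ∂(μ.prod ν) = h r * b := by
      rw [integral_prod_symm _ intc]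
      have : ∀ y, ∫ x, D.indicator (fun _ => (1:ℝ)) (x, y) ∂μ = h r := by
        intro y
        have : (fun x => D.indicator (fun _ : S × S => (1:ℝ)) (x, y))
          = (ball y r).indicator (fun _ => 1) := by
          ext y; simp [Set.indicator, hD]
        rw [this, integral_indicator measurableSet_ball, setIntegral_const, hμ, smul_eq_mul, mul_one]
      simp only [this, integral_const, smul_eq_mul]
      rw [← hb]; ring
    have e5 : |k r * ∫ x, f x ∂μ - h r * ∫ x, f x ∂ν| ≤ ε * (k r * a) := by
      rw [← e1, ← e2, ← integral_sub int1 int2, ← e3, ← integral_const_mul]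
      refine (abs_integral_le_integral_abs).trans ?_
      refine integral_mono (int1.sub int2).abs (intc.const_mul _) ?_
      intro p
      by_cases hp : p ∈ D
      · have := hfr hp
        simp only [Set.indicator, hp, if_true]
        rw [Real.dist_eq] at this
        linarith
      · simp [Set.indicator, hp]
    have hkr := hk r hr
    have e6 : h r * b = k r * a := by rw [← e3, e4]
    have : k r * |b * ∫ x, f x ∂μ - a * ∫ x, f x ∂ν| ≤ k r * (ε * (a * b)) := by
      calc k r * |b * ∫ x, f x ∂μ - a * ∫ x, f x ∂ν|
          = |b * (k r * ∫ x, f x ∂μ - h r * ∫ x, f x ∂ν)| := by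
            rw [← abs_of_pos hkr, ← abs_mul, abs_of_pos hkr]
            congr 1
            linear_combination (∫ x, f x ∂ν) * e6
        _ = b * |k r * ∫ x, f x ∂μ - h r * ∫ x, f x ∂ν| := by rw [abs_mul, abs_of_nonneg hb0]
        _ ≤ b * (ε * (k r * a)) := by gcongr
        _ = _ := by ring
    exact le_of_mul_le_mul_left this hkr
  have : |b * ∫ x, f x ∂μ - a * ∫ x, f x ∂ν| ≤ 0 := by
    apply le_of_forall_pos_le_add
    intro δ hδ
    have hab : 0 ≤ a * b := by positivity
    refine (key (δ / (a * b + 1)) (by positivity)).trans ?_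
    rw [zero_add, div_mul_eq_mul_div, div_le_iff₀ (by positivity)]
    nlinarith
  exact sub_eq_zero.1 (abs_eq_zero.1 (le_antisymm this (abs_nonneg _)))

abbrev S2 : Type := sphere (0 : V3) 1

/-- the isometry of the sphere induced by a linear isometry -/
def sphIso (e : V3 ≃ₗᵢ[ℝ] V3) : S2 ≃ᵢ S2 where
  toFun x := ⟨e x, by simp⟩
  invFun x := ⟨e.symm x, by simp⟩
  left_inv x := by simp
  right_inv x := by simp
  isometry_toFun := by
    intro x y
    simp [Subtype.edist_eq]

lemma exists_iso (x y : S2) : ∃ e : V3 ≃ₗᵢ[ℝ] V3, sphIso e x = y := by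
  refine ⟨(ℝ ∙ ((x:V3) - y))ᗮ.reflection, ?_⟩
  apply Subtype.ext
  exact Submodule.reflection_sub (by simp)

lemma haus_ball (x y : S2) (r : ℝ) : (μH[2] : Measure S2) (ball x r) = μH[2] (ball y r) := by
  obtain ⟨e, he⟩ := exists_iso x y
  rw [← he, ← IsometryEquiv.image_ball, IsometryEquiv.hausdorffMeasure_image]

lemma toSphere_ball (x y : S2) (r : ℝ) :
    (volume : Measure V3).toSphere (ball x r) = (volume : Measure V3).toSphere (ball y r) := by
  obtain ⟨e, he⟩ := exists_iso x y
  rw [Measure.toSphere_apply' _ measurableSet_ball, Measure.toSphere_apply' _ measurableSet_ball]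
  congr 1
  rw [← he, ← IsometryEquiv.image_ball, Set.image_image]
  have : (fun z : S2 => ((sphIso e z : S2) : V3)) = fun z : S2 => e z := rfl
  rw [this, ← Set.image_image (fun z => e z) (fun z : S2 => (z : V3))]
  symm
  rw [← e.measurePreserving.measure_preimage_emb e.toHomeomorph.measurableEmbedding]
  congr 1
  ext z
  simp only [Set.mem_smul, Set.mem_preimage, Set.mem_image, exists_exists_and_eq_and]
  constructor
  · rintro ⟨s, hs, w, hw, h⟩
    exact ⟨s, hs, w, hw, e.injective (by simpa using h)⟩
  · rintro ⟨s, hs, w, hw, rfl⟩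
    exact ⟨s, hs, w, hw, by simp⟩

lemma haus_image (s : Set S2) : (μH[2] : Measure S2) s = μH[2] ((↑) '' s : Set V3) :=
  (isometry_subtype_coe.hausdorffMeasure_image (Or.inl (by norm_num)) s).symm

lemma haus_pos : 0 < (μH[2] : Measure S2) Set.univ := by
  let L : V3 →L[ℝ] ℝ × ℝ := (EuclideanSpace.proj 0).prod (EuclideanSpace.proj 1)
  have h1 := L.lipschitz.hausdorffMeasure_image_le (d := 2) (by norm_num) (sphere (0:V3) 1)
  have h2 : ball (0 : ℝ × ℝ) (1/2) ⊆ L '' (sphere (0:V3) 1) := by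
    rintro ⟨a, b⟩ hab
    rw [mem_ball_zero_iff, Prod.norm_def, max_lt_iff] at hab
    obtain ⟨ha, hb⟩ := hab
    simp only [Real.norm_eq_abs, abs_lt] at ha hb
    have hnn : 0 ≤ 1 - a^2 - b^2 := by nlinarith
    refine ⟨!₂[a, b, Real.sqrt (1 - a^2 - b^2)], ?_, ?_⟩
    · rw [mem_sphere_zero_iff_norm, EuclideanSpace.norm_eq, Real.sqrt_eq_one]
      simp [Fin.sum_univ_three, Real.sq_sqrt hnn]
    · simp [L]
  have h3 : 0 < (μH[2] : Measure (ℝ × ℝ)) (ball 0 (1/2)) := by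
    rw [hausdorffMeasure_prod_real]
    exact measure_ball_pos _ _ (by norm_num)
  have h4 := (h3.trans_le (measure_mono h2)).trans_le h1
  rw [haus_image]
  simp only [Set.image_univ, Subtype.range_coe_subtype, Set.ofPred_mem_eq]
  exact (ENNReal.mul_pos_iff.1 h4).2

lemma haus_lt_top : (μH[2] : Measure S2) Set.univ < ⊤ := by
  let Φ : ℝ × ℝ → V3 := fun p =>
    !₂[Real.sin p.1 * Real.cos p.2, Real.sin p.1 * Real.sin p.2, Real.cos p.1]
  have hΦ : ContDiff ℝ 1 Φ := by
    rw [contDiff_euclidean]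
    intro i
    fin_cases i <;> simp [Φ] <;> fun_prop
  let Q : Set (ℝ × ℝ) := closedBall 0 4
  obtain ⟨K, hK⟩ := hΦ.contDiffOn.exists_lipschitzOnWith (s := Q) (by norm_num)
    (convex_closedBall _ _) (isCompact_closedBall _ _)
  have h1 := hK.hausdorffMeasure_image_le (d := 2) (by norm_num)
  have h2 : sphere (0:V3) 1 ⊆ Φ '' Q := by
    intro x hx
    rw [mem_sphere_zero_iff_norm, EuclideanSpace.norm_eq, Real.sqrt_eq_one] at hx
    simp only [Fin.sum_univ_three, Real.norm_eq_abs, sq_abs] at hx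
    let z : ℂ := ⟨x 0, x 1⟩
    have hz : ‖z‖ = Real.sqrt (1 - x 2 ^ 2) := by
      rw [Complex.norm_eq_sqrt_sq_add_sq]; congr 1; simp only [z]; linarith
    have hpi := Real.pi_lt_four
    refine ⟨(Real.arccos (x 2), Complex.arg z), ?_, ?_⟩
    · simp only [Q, mem_closedBall_zero_iff, Prod.norm_def, max_le_iff, Real.norm_eq_abs]
      constructor
      · rw [abs_of_nonneg (Real.arccos_nonneg _)]
        exact (Real.arccos_le_pi _).trans hpi.le
      · exact (Complex.abs_arg_le_pi _).trans hpi.le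
    · ext i
      have hc : Real.cos (Real.arccos (x 2)) = x 2 :=
        Real.cos_arccos (by nlinarith [sq_nonneg (x 0), sq_nonneg (x 1)])
          (by nlinarith [sq_nonneg (x 0), sq_nonneg (x 1)])
      have h0 := Complex.norm_mul_cos_arg z
      have h1 := Complex.norm_mul_sin_arg z
      rw [hz] at h0 h1
      fin_cases i
      · simpa [Φ, Real.sin_arccos] using h0
      · simpa [Φ, Real.sin_arccos] using h1
      · simpa [Φ] using hc
  rw [haus_image]
  simp only [Set.image_univ, Subtype.range_coe_subtype, Set.ofPred_mem_eq]
  refine ((measure_mono h2).trans h1).trans_lt ?_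
  refine ENNReal.mul_lt_top (ENNReal.rpow_lt_top_of_nonneg (by norm_num) ENNReal.coe_ne_top) ?_
  rw [hausdorffMeasure_prod_real]
  exact (isCompact_closedBall _ _).measure_lt_top

instance : IsFiniteMeasure (μH[2] : Measure S2) := ⟨haus_lt_top⟩

abbrev σ2 : Measure S2 := (volume : Measure V3).toSphere

lemma haus_eq : ∃ κ : ℝ, 0 < κ ∧ (μH[2] : Measure S2) = ENNReal.ofReal κ • σ2 := by
  have hne : Nonempty S2 := (NormedSpace.sphere_nonempty (x := (0:V3)) (r := 1)).2 (by norm_num) |>.to_subtype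
  obtain ⟨x0⟩ := hne
  have hb : 0 < σ2.real Set.univ := by
    rw [measureReal_def, ENNReal.toReal_pos_iff]
    refine ⟨?_, measure_lt_top _ _⟩
    rw [Measure.measure_univ_pos]
    exact Measure.toSphere_ne_zero _
  have ha : 0 < (μH[2] : Measure S2).real Set.univ :=
    ENNReal.toReal_pos haus_pos.ne' haus_lt_top.ne
  refine ⟨(μH[2] : Measure S2).real Set.univ / σ2.real Set.univ, div_pos ha hb, ?_⟩
  have := Measure.smul_finite σ2 (ENNReal.ofReal_ne_top
    (r := (μH[2] : Measure S2).real Set.univ / σ2.real Set.univ))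
  apply ext_of_forall_integral_eq_of_IsFiniteMeasure
  intro f
  have := unif_unique (μH[2] : Measure S2) σ2 (fun r => (μH[2] : Measure S2).real (ball x0 r))
    (fun r => σ2.real (ball x0 r)) (fun r x => by simp only [measureReal_def, haus_ball x x0])
    (fun r x => by simp only [measureReal_def, toSphere_ball x x0])
    (fun r hr => by
      rw [measureReal_def, ENNReal.toReal_pos_iff]
      exact ⟨measure_ball_pos _ _ hr, measure_lt_top _ _⟩) f f.continuous
  rw [integral_smul_measure, ENNReal.toReal_ofReal (div_pos ha hb).le, smul_eq_mul]
  field_simp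
  linarith

lemma haus_sphere : ∃ κ : ℝ, 0 < κ ∧ ∀ (c : V3) (R : ℝ), 0 < R → ∀ h : V3 → ℝ,
    ∫ x in sphere c R, h x ∂μH[2] = κ * (R ^ 2 * ∫ ω : S2, h (c + R • (ω : V3)) ∂σ2) := by
  obtain ⟨κ, hκ, he⟩ := haus_eq
  refine ⟨κ, hκ, fun c R hR h => ?_⟩
  let φ : V3 ≃ₜ V3 := (Homeomorph.smulOfNeZero R hR.ne').trans (Homeomorph.addLeft c)
  have hφ : ∀ x, φ x = c + R • x := fun x => rfl
  have hmap : (μH[2] : Measure V3) = ENNReal.ofReal (R ^ 2) • Measure.map φ μH[2] := by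
    have h1 : Measure.map φ μH[2] = Measure.map (fun x => c + x) (Measure.map (AffineMap.homothety (0:V3) R) μH[2]) := by
      rw [Measure.map_map (by fun_prop) (AffineMap.homothety_continuous _ _).measurable]
      congr 1
      ext x
      simp [hφ, AffineMap.homothety_apply]
    rw [h1, map_homothety_hausdorffMeasure (by norm_num) _ hR.ne', Measure.map_smul]
    have h2 : Measure.map (fun x => c + x) (μH[2] : Measure V3) = μH[2] :=
      (IsometryEquiv.addLeft c).map_hausdorffMeasure 2
    rw [h2]
    ext s hs
    simp only [Measure.smul_apply, smul_eq_mul, ENNReal.smul_def]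
    rw [← mul_assoc]
    have h3 : ENNReal.ofReal (R ^ 2) * ((‖R‖₊⁻¹ ^ (2:ℝ) : NNReal) : ENNReal) = 1 := by
      rw [← ENNReal.ofReal_coe_nnreal, ← ENNReal.ofReal_mul (by positivity), ENNReal.ofReal_eq_one]
      have : (2:ℝ) = ((2:ℕ):ℝ) := by norm_num
      rw [this, NNReal.rpow_natCast]
      simp [hR.ne']
    rw [h3, one_mul]
  have hpre : φ ⁻¹' (sphere c R) = sphere 0 1 := by
    ext x
    simp [hφ, norm_smul, abs_of_pos hR, hR.ne']
  have hS : ∀ g : V3 → ℝ, ∫ x in sphere (0:V3) 1, g x ∂μH[2] = ∫ ω : S2, g ω ∂μH[2] := by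
    intro g
    have := (isometry_subtype_coe (s := sphere (0:V3) 1)).map_hausdorffMeasure (d := 2) (Or.inl (by norm_num))
    rw [Subtype.range_coe] at this
    rw [← this, (MeasurableEmbedding.subtype_coe isClosed_sphere.measurableSet).integral_map]
  calc ∫ x in sphere c R, h x ∂μH[2] 
      = R ^ 2 * ∫ x in sphere c R, h x ∂(Measure.map φ μH[2]) := by
        conv_lhs => rw [hmap]
        rw [Measure.restrict_smul, integral_smul_measure, ENNReal.toReal_ofReal (by positivity), smul_eq_mul]
    _ = R ^ 2 * ∫ ω : S2, h (c + R • (ω : V3)) ∂μH[2] := by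
        rw [φ.measurableEmbedding.setIntegral_map, hpre, hS]
        rfl
    _ = _ := by
        rw [he, integral_smul_measure, ENNReal.toReal_ofReal hκ.le, smul_eq_mul]; ring

lemma polar3 (h : V3 → ℝ) (hh : Integrable h) :
    ∫ x, h x = ∫ u in Set.Ioi (0:ℝ), u ^ 2 * ∫ ω : S2, h (u • (ω : V3)) ∂σ2 := by
  have hmp := (volume : Measure V3).measurePreserving_homeomorphUnitSphereProd
  have hdim : Module.finrank ℝ V3 - 1 = 2 := by simp
  rw [hdim] at hmp
  have e1 : ∀ x : ({0}ᶜ : Set V3), h x =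
      (fun p : S2 × Set.Ioi (0:ℝ) => h ((p.2 : ℝ) • (p.1 : V3))) (homeomorphUnitSphereProd V3 x) := by
    intro x
    have hx : ‖(x:V3)‖ ≠ 0 := by
      have h0 : (x:V3) ≠ 0 := x.2
      simpa using h0
    simp [homeomorphUnitSphereProd_apply_fst_coe, homeomorphUnitSphereProd_apply_snd_coe, smul_smul, hx]
  have hIntg : Integrable (fun p : S2 × Set.Ioi (0:ℝ) => h ((p.2 : ℝ) • (p.1 : V3)))
      (σ2.prod (Measure.volumeIoiPow 2)) := by
    rw [← hmp.integrable_comp_emb (Homeomorph.measurableEmbedding _)]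
    have : (fun p : S2 × Set.Ioi (0:ℝ) => h ((p.2 : ℝ) • (p.1 : V3))) ∘ (homeomorphUnitSphereProd V3)
       = fun x : ({0}ᶜ : Set V3) => h x := by ext x; exact (e1 x).symm
    rw [this]
    have h2 := (integrableOn_iff_comap_subtypeVal (μ := (volume : Measure V3)) (f := h)
      (measurableSet_singleton (0:V3)).compl).1 hh.integrableOn
    exact h2
  calc
    ∫ x, h x = ∫ x : ({0}ᶜ : Set V3), h x ∂((volume : Measure V3).comap (↑)) := by
      rw [integral_subtype_comap (measurableSet_singleton _).compl fun x ↦ h x,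
        restrict_compl_singleton]
    _ = ∫ p : S2 × Set.Ioi (0:ℝ), h ((p.2 : ℝ) • (p.1 : V3)) ∂(σ2.prod (Measure.volumeIoiPow 2)) := by
      rw [← hmp.integral_comp (Homeomorph.measurableEmbedding _)]
      exact integral_congr_ae (Eventually.of_forall e1)
    _ = ∫ u : Set.Ioi (0:ℝ), (∫ ω : S2, h ((u:ℝ) • (ω : V3)) ∂σ2) ∂(Measure.volumeIoiPow 2) :=
      integral_prod_symm _ hIntg
    _ = _ := by
      simp only [Measure.volumeIoiPow, ENNReal.ofReal]
      rw [integral_withDensity_eq_integral_smul,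
        integral_subtype_comap measurableSet_Ioi
          fun a ↦ Real.toNNReal (a ^ 2) • ∫ ω : S2, h ((a:ℝ) • (ω : V3)) ∂σ2,
        setIntegral_congr_fun measurableSet_Ioi fun x hx ↦ ?_]
      · beta_reduce
        rw [NNReal.smul_def, Real.coe_toNNReal _ (pow_nonneg (le_of_lt hx) _), smul_eq_mul]
      · exact (measurable_subtype_coe.pow_const _).real_toNNReal

/-- radial cutoff -/
lemma cutoff (R : ℝ) (k : ℝ → ℝ) (hk : Continuous k) (hs : tsupport k ⊆ Set.Ioo 0 R)
    (hc : HasCompactSupport k) (hR : 0 < R) (v : V3) :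
    let η : ℝ → ℝ := fun u => - ∫ w in u..R, w * k w
    (∃ b, b < R ∧ ∀ u, b ≤ u → η u = 0) ∧ Continuous η ∧
    ∀ x : V3, HasLineDerivAt ℝ (fun x : V3 => η ‖x‖) (k ‖x‖ * inner ℝ x v) x v := by
  intro η
  have hη : ∀ u, HasDerivAt η (u * k u) u := by
    intro u
    have hcw : Continuous fun w => w * k w := by fun_prop
    have := (intervalIntegral.integral_hasDerivAt_left (hcw.intervalIntegrable u R)
      hcw.stronglyMeasurable.stronglyMeasurableAtFilter hcw.continuousAt).neg
    rw [neg_neg] at this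
    exact this
  have hcont : Continuous η := continuous_iff_continuousAt.2 fun u => (hη u).continuousAt
  obtain ⟨a, b, ha, hab, hb, hz⟩ : ∃ a b : ℝ, 0 < a ∧ a ≤ b ∧ b < R ∧ ∀ u, u ∉ Set.Icc a b → k u = 0 := by
    by_cases hne : (tsupport k).Nonempty
    · obtain ⟨a, ha⟩ := hc.isCompact.exists_isLeast hne
      obtain ⟨b, hb⟩ := hc.isCompact.exists_isGreatest hne
      refine ⟨a, b, (hs ha.1).1, ha.2 hb.1, (hs hb.1).2, fun u hu => ?_⟩
      by_contra hne
      have : u ∈ tsupport k := subset_tsupport _ hne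
      exact hu ⟨ha.2 this, hb.2 this⟩
    · refine ⟨R/2, R/2, by linarith, le_rfl, by linarith, fun u _ => ?_⟩
      by_contra hne'
      exact hne ⟨u, subset_tsupport _ hne'⟩
  refine ⟨⟨(b + R)/2, by linarith, fun u hu => ?_⟩, hcont, fun x => ?_⟩
  · simp only [η, neg_eq_zero]
    apply intervalIntegral.integral_zero_ae
    refine Eventually.of_forall fun w hw => ?_
    have : b < w := by
      rcases Set.mem_uIoc.1 hw with h | h <;> linarith [h.1, h.2]
    rw [hz w (fun h => by linarith [h.2]), mul_zero]
  · by_cases hx : x = 0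
    · subst hx
      have h1 : (fun x : V3 => η ‖x‖) =ᶠ[𝓝 0] fun _ => η 0 := by
        filter_upwards [ball_mem_nhds (0:V3) ha] with y hy
        rw [mem_ball_zero_iff] at hy
        have : ∫ w in (0:ℝ)..‖y‖, w * k w = 0 := by
          apply intervalIntegral.integral_zero_ae
          refine Eventually.of_forall fun w hw => ?_
          rw [Set.uIoc_of_le (norm_nonneg _)] at hw
          rw [hz w (fun h => by linarith [h.1, hw.2]), mul_zero]
        have hcw : Continuous fun w => w * k w := by fun_prop
        have h2 := intervalIntegral.integral_add_adjacent_intervals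
          (hcw.intervalIntegrable (μ := volume) 0 ‖y‖) (hcw.intervalIntegrable ‖y‖ R)
        simp only [η]
        rw [← h2, this, zero_add]
      have h2 : HasFDerivAt (fun x : V3 => η ‖x‖) (0 : V3 →L[ℝ] ℝ) 0 :=
        (hasFDerivAt_const _ _).congr_of_eventuallyEq h1
      have := h2.hasLineDerivAt v
      simpa using this
    · have hn : ‖x‖ ≠ 0 := norm_ne_zero_iff.2 hx
      have hl : HasDerivAt (fun t : ℝ => x + t • v) v 0 := by
        simpa using ((hasDerivAt_id (0:ℝ)).smul_const v).const_add x
      have h1 := hl.norm_sq.sqrt (by simpa using hn)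
      simp only [Real.sqrt_sq (norm_nonneg _), zero_smul, add_zero] at h1
      have h2 : HasDerivAt η (‖x‖ * k ‖x‖) ((fun t : ℝ => ‖x + t • v‖) 0) := by
        simpa using hη ‖x‖
      have h3 := h2.comp (0:ℝ) h1
      refine h3.congr_deriv ?_
      field_simp

lemma grad_ball_aux (R : ℝ) (hR : 0 < R) (v : V3) (f g : V3 → ℝ) (hf : Continuous f)
    (hg : Continuous g) (hd : ∀ x ∈ ball (0:V3) R, HasLineDerivAt ℝ f (g x) x v) :
    ∫ x in closedBall (0:V3) R, g x = R ^ 2 * ∫ ω : S2, f (R • (ω : V3)) * inner ℝ (ω : V3) v ∂σ2 := by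
  set A : ℝ → ℝ := fun u => u ^ 2 * ∫ ω : S2, f (u • (ω : V3)) * inner ℝ (ω : V3) v ∂σ2 with hA
  set D : ℝ → ℝ := fun w => ∫ x in closedBall (0:V3) R, (ball (0:V3) w).indicator g x with hD
  have hAc : Continuous A := by
    have : Continuous fun u : ℝ => ∫ ω : S2, f (u • (ω : V3)) * inner ℝ (ω : V3) v ∂σ2 := by
      have := continuous_parametric_integral_of_continuous (μ := σ2)
        (f := fun (u : ℝ) (ω : S2) => f (u • (ω : V3)) * inner ℝ (ω : V3) v)
        (by simp only [Function.uncurry_def]; fun_prop) isCompact_univ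
      simpa using this
    fun_prop
  have hgi : IntegrableOn g (closedBall (0:V3) R) :=
    hg.continuousOn.integrableOn_compact (isCompact_closedBall _ _)
  have hDc : Continuous D := by
    rw [continuous_iff_continuousAt]
    intro w
    apply continuousAt_of_dominated (bound := fun x => ‖g x‖)
    · exact Eventually.of_forall fun w => (hg.aestronglyMeasurable.indicator measurableSet_ball)
    · exact Eventually.of_forall fun w => Eventually.of_forall fun x => norm_indicator_le_norm_self _ _
    · exact hgi.norm
    · have h0 : ∀ᵐ x : V3 ∂(volume.restrict (closedBall (0:V3) R)), x ∉ sphere (0:V3) w :=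
        ae_restrict_of_ae (measure_eq_zero_iff_ae_notMem.1 (Measure.addHaar_sphere _ _ _))
      filter_upwards [h0] with x hx
      rw [mem_sphere_zero_iff_norm] at hx
      rcases lt_or_gt_of_ne hx with h | h
      · apply (continuousAt_const (y := g x)).congr
        filter_upwards [lt_mem_nhds h] with u hu
        rw [Set.indicator_of_mem (by simpa using hu)]
      · apply (continuousAt_const (y := (0:ℝ))).congr
        filter_upwards [gt_mem_nhds h] with u hu
        rw [Set.indicator_of_notMem (by simpa using hu.le)]
  have key : ∀ k : ℝ → ℝ, ContDiff ℝ (⊤ : ℕ∞) k → HasCompactSupport k → tsupport k ⊆ Set.Ioo 0 R →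
      ∫ u, k u • (u * (A u - D u)) = 0 := by
    intro k hks hkc hkS
    have hk := hks.continuous
    obtain ⟨⟨b, hb, hz⟩, hη, hder⟩ := cutoff R k hk hkS hkc hR v
    set η : ℝ → ℝ := fun u => - ∫ w in u..R, w * k w with hηd
    have hk0 : ∀ u, u ∉ Set.Ioo 0 R → k u = 0 := fun u hu => by
      by_contra hne
      exact hu (hkS (subset_tsupport _ hne))
    have hψs : Function.support (fun x : V3 => η ‖x‖) ⊆ closedBall 0 b := by
      intro x hx
      by_contra hxb
      rw [mem_closedBall_zero_iff, not_le] at hxb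
      exact hx (hz _ hxb.le)
    have hψts : tsupport (fun x : V3 => η ‖x‖) ⊆ closedBall 0 b :=
      closure_minimal hψs isClosed_closedBall
    have hψc : HasCompactSupport (fun x : V3 => η ‖x‖) :=
      HasCompactSupport.of_support_subset_isCompact (isCompact_closedBall _ _) hψs
    have hψ'c : HasCompactSupport (fun x : V3 => k ‖x‖ * inner ℝ x v) := by
      apply HasCompactSupport.of_support_subset_isCompact (isCompact_closedBall (0:V3) R)
      intro x hx
      by_contra hxb
      rw [mem_closedBall_zero_iff, not_le] at hxb
      exact hx (by simp [hk0 ‖x‖ (fun h => by linarith [h.2])])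
    have i1 : Integrable (fun x : V3 => (k ‖x‖ * inner ℝ x v) * f x) :=
      Continuous.integrable_of_hasCompactSupport (by fun_prop) hψ'c.mul_right
    have i2 : Integrable (fun x : V3 => η ‖x‖ * g x) :=
      Continuous.integrable_of_hasCompactSupport (by fun_prop) hψc.mul_right
    have i3 : Integrable (fun x : V3 => η ‖x‖ * f x) :=
      Continuous.integrable_of_hasCompactSupport (by fun_prop) hψc.mul_right
    have ibp := integral_bilinear_hasLineDerivAt_right_eq_neg_left_of_integrable
      (B := ContinuousLinearMap.mul ℝ ℝ) (f := fun x : V3 => η ‖x‖)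
      (f' := fun x : V3 => k ‖x‖ * inner ℝ x v) (g := f) (g' := g) (v := v)
      i1 i2 i3 (fun x _ => hder x) (fun x hx => hd x (by
        have := hψts hx
        rw [mem_closedBall_zero_iff] at this
        rw [mem_ball_zero_iff]; linarith))
    simp only [ContinuousLinearMap.mul_apply'] at ibp
    have e1 : ∫ x : V3, (k ‖x‖ * inner ℝ x v) * f x = ∫ u, k u * (u * A u) := by
      rw [polar3 _ i1]
      have : ∀ u, u ∉ Set.Ioi (0:ℝ) → k u * (u * A u) = 0 := fun u hu => by
        rw [hk0 u (fun h => hu h.1), zero_mul]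
      rw [← setIntegral_eq_integral_of_forall_compl_eq_zero this]
      refine setIntegral_congr_fun measurableSet_Ioi fun u hu => ?_
      have hu' : (0:ℝ) < u := hu
      simp only [hA]
      rw [show k u * (u * (u ^ 2 * ∫ ω : S2, f (u • (ω : V3)) * inner ℝ (ω : V3) v ∂σ2))
        = u ^ 2 * ((k u * u) * ∫ ω : S2, f (u • (ω : V3)) * inner ℝ (ω : V3) v ∂σ2) by ring,
        ← integral_const_mul (k u * u)]
      beta_reduce
      congr 1
      refine integral_congr_ae (Eventually.of_forall fun ω => ?_)
      beta_reduce
      have : ‖u • (ω : V3)‖ = u := by simp [norm_smul, abs_of_pos hu']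
      rw [this, real_inner_smul_left]; ring
    have e2 : ∫ x : V3, η ‖x‖ * g x = - ∫ u, k u * (u * D u) := by
      have h1 : ∫ x : V3, η ‖x‖ * g x = ∫ x in closedBall (0:V3) R, η ‖x‖ * g x := by
        symm
        apply setIntegral_eq_integral_of_forall_compl_eq_zero
        intro x hx
        rw [mem_closedBall_zero_iff, not_le] at hx
        rw [hz _ (hb.trans hx).le, zero_mul]
      have hki : Integrable (fun w => w * k w) :=
        Continuous.integrable_of_hasCompactSupport (by fun_prop) hkc.mul_left
      let T : Set (V3 × ℝ) := {p | ‖p.1‖ < p.2}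
      have hT : MeasurableSet T := (isOpen_lt (by fun_prop) (by fun_prop)).measurableSet
      have hI : Integrable (T.indicator (fun p : V3 × ℝ => g p.1 * (p.2 * k p.2)))
          ((volume.restrict (closedBall (0:V3) R)).prod volume) :=
        (Integrable.mul_prod hgi hki).indicator hT
      have h2 : ∀ x : V3, x ∈ closedBall (0:V3) R → η ‖x‖ * g x =
          - ∫ w, T.indicator (fun p : V3 × ℝ => g p.1 * (p.2 * k p.2)) (x, w) := by
        intro x hx
        rw [mem_closedBall_zero_iff] at hx
        have : (fun w => T.indicator (fun p : V3 × ℝ => g p.1 * (p.2 * k p.2)) (x, w))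
          = fun w => g x * (Set.Ioc ‖x‖ R).indicator (fun w => w * k w) w := by
          ext w
          by_cases h1 : ‖x‖ < w
          · by_cases h2 : w ≤ R
            · simp [Set.indicator, T, h1, h2]
            · simp [Set.indicator, T, h1, h2, hk0 w (fun h => h2 h.2.le)]
          · simp [Set.indicator, T, h1]
        rw [this, integral_const_mul, integral_indicator measurableSet_Ioc,
          ← intervalIntegral.integral_of_le hx]
        simp only [hηd]; ring
      rw [h1, setIntegral_congr_fun measurableSet_closedBall h2, integral_neg, neg_inj,
        integral_integral_swap (f := fun x w => T.indicator (fun p : V3 × ℝ => g p.1 * (p.2 * k p.2)) (x, w)) hI]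
      congr 1
      ext w
      have : (fun x => T.indicator (fun p : V3 × ℝ => g p.1 * (p.2 * k p.2)) (x, w))
          = fun x => (w * k w) * (ball (0:V3) w).indicator g x := by
        ext x
        by_cases h1 : ‖x‖ < w
        · simp [Set.indicator, T, h1]; ring
        · simp [Set.indicator, T, h1]
      rw [this, integral_const_mul]
      simp only [hD]; ring
    have j1 : Integrable (fun u => k u * (u * A u)) :=
      Continuous.integrable_of_hasCompactSupport (by fun_prop) hkc.mul_right
    have j2 : Integrable (fun u => k u * (u * D u)) :=
      Continuous.integrable_of_hasCompactSupport (by fun_prop) hkc.mul_right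
    have : ∀ u, k u • (u * (A u - D u)) = k u * (u * A u) - k u * (u * D u) := fun u => by
      simp only [smul_eq_mul]; ring
    simp only [this]
    rw [integral_sub j1 j2, ← e1]
    linarith
  have hae := isOpen_Ioo.ae_eq_zero_of_integral_contDiff_smul_eq_zero (μ := (volume : Measure ℝ))
    (f := fun u => u * (A u - D u)) (U := Set.Ioo 0 R)
    ((by fun_prop : Continuous fun u => u * (A u - D u)).locallyIntegrable.locallyIntegrableOn _) key
  have hAD : A R - D R = 0 := by
    have ht : Tendsto (fun u => A u - D u) (𝓝[<] R) (𝓝 (A R - D R)) :=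
      ((hAc.sub hDc).tendsto R).mono_left nhdsWithin_le_nhds
    refine isClosed_singleton.mem_of_frequently_of_tendsto (s := {(0:ℝ)}) ?_ ht
    intro hev
    obtain ⟨c, hc, hcs⟩ := (mem_nhdsLT_iff_exists_Ioo_subset).1 hev
    have hpos : 0 < volume (Set.Ioo (max c 0) R) := by
      rw [Real.volume_Ioo, ENNReal.ofReal_pos, sub_pos]
      exact max_lt hc hR
    have hzero : volume (Set.Ioo (max c 0) R) = 0 := by
      refine measure_mono_null ?_ (ae_iff.1 hae)
      intro u hu
      have h0 : 0 < u := (le_max_right _ _).trans_lt hu.1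
      have := hcs ⟨(le_max_left _ _).trans_lt hu.1, hu.2⟩
      simp only [Set.mem_ofPred_eq, Set.mem_singleton_iff] at this ⊢
      intro hcon
      exact this ((mul_eq_zero.1 (hcon ⟨h0, hu.2⟩)).resolve_left h0.ne')
    exact hpos.ne' hzero
  have hDR : D R = ∫ x in closedBall (0:V3) R, g x := by
    simp only [hD]
    apply integral_congr_ae
    have h0 : ∀ᵐ x : V3 ∂(volume.restrict (closedBall (0:V3) R)), x ∉ sphere (0:V3) R :=
        ae_restrict_of_ae (measure_eq_zero_iff_ae_notMem.1 (Measure.addHaar_sphere _ _ _))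
    filter_upwards [h0, ae_restrict_mem measurableSet_closedBall] with x hx hx2
    rw [Set.indicator_of_mem]
    rw [mem_sphere_zero_iff_norm] at hx
    rw [mem_closedBall_zero_iff] at hx2
    exact mem_ball_zero_iff.2 (lt_of_le_of_ne hx2 hx)
  rw [← hDR]
  have : A R = D R := by linarith
  rw [← this]

lemma extend_cont (R : ℝ) (f : V3 → ℝ) (hf : ContinuousOn f (closedBall 0 R)) :
    ∃ F : V3 → ℝ, Continuous F ∧ ∀ x ∈ closedBall (0:V3) R, F x = f x := by
  obtain ⟨G, hG⟩ := ContinuousMap.exists_restrict_eq (isClosed_closedBall (x := (0:V3)) (ε := R))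
    ⟨_, hf.domRestrict⟩
  refine ⟨G, G.continuous, fun x hx => ?_⟩
  exact congrArg (fun h => h ⟨x, hx⟩) hG

lemma grad_ball (R : ℝ) (hR : 0 < R) (v : V3) (f g : V3 → ℝ) (hf : ContinuousOn f (closedBall 0 R))
    (hg : ContinuousOn g (closedBall 0 R))
    (hd : ∀ x ∈ ball (0:V3) R, HasLineDerivAt ℝ f (g x) x v) :
    ∫ x in closedBall (0:V3) R, g x = R ^ 2 * ∫ ω : S2, f (R • (ω : V3)) * inner ℝ (ω : V3) v ∂σ2 := by
  obtain ⟨F, hF, hFf⟩ := extend_cont R f hf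
  obtain ⟨G, hG, hGg⟩ := extend_cont R g hg
  have := grad_ball_aux R hR v F G hF hG (fun x hx => by
    rw [hGg x (ball_subset_closedBall hx)]
    refine (hd x hx).congr_of_eventuallyEq ?_
    filter_upwards [isOpen_ball.mem_nhds hx] with y hy
    exact hFf y (ball_subset_closedBall hy))
  rw [setIntegral_congr_fun measurableSet_closedBall hGg] at this
  rw [this]
  congr 2
  ext ω
  rw [hFf _ (by simp [norm_smul, abs_of_pos hR])]

lemma time_ftc (Tm Tp R : ℝ) (f g : ℝ × V3 → ℝ)
    (hf : ContinuousOn f (Set.Icc Tm Tp ×ˢ closedBall (0:V3) R))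
    (hg : ContinuousOn g (Set.Icc Tm Tp ×ˢ closedBall (0:V3) R))
    (hd : ∀ s ∈ Set.Ioo Tm Tp, ∀ y ∈ ball (0:V3) R, HasDerivAt (fun s => f (s, y)) (g (s, y)) s)
    (a b : ℝ) (ha : a ∈ Set.Icc Tm Tp) (hb : b ∈ Set.Icc Tm Tp) (hR : 0 < R) :
    ∫ s in a..b, ∫ y in closedBall (0:V3) R, g (s, y) =
      (∫ y in closedBall (0:V3) R, f (b, y)) - ∫ y in closedBall (0:V3) R, f (a, y) := by
  have hsub : Set.uIcc a b ⊆ Set.Icc Tm Tp := Set.uIcc_subset_Icc ha hb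
  have hIntg : Integrable (Function.uncurry fun s y => g (s, y))
      ((volume.restrict (Set.uIoc a b)).prod (volume.restrict (closedBall (0:V3) R))) := by
    rw [Measure.prod_restrict]
    have h1 : IntegrableOn g (Set.Icc Tm Tp ×ˢ closedBall (0:V3) R)
        ((volume : Measure ℝ).prod (volume : Measure V3)) :=
      hg.integrableOn_compact (isCompact_Icc.prod (isCompact_closedBall _ _))
    exact h1.mono_set (Set.prod_mono (Set.uIoc_subset_uIcc.trans hsub) le_rfl)
  rw [intervalIntegral_integral_swap hIntg]
  have hslice : ∀ c ∈ Set.Icc Tm Tp, IntegrableOn (fun y => f (c, y)) (closedBall (0:V3) R) := by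
    intro c hc
    have h1 : ContinuousOn (fun y : V3 => f (c, y)) (closedBall (0:V3) R) :=
      hf.comp (by fun_prop) (fun y hy => ⟨hc, hy⟩)
    exact h1.integrableOn_compact (isCompact_closedBall _ _)
  rw [← integral_sub (hslice b hb) (hslice a ha)]
  apply integral_congr_ae
  have hsph : ∀ᵐ y ∂(volume.restrict (closedBall (0:V3) R)), y ∈ ball (0:V3) R := by
    rw [ae_restrict_iff' measurableSet_closedBall]
    have : ∀ᵐ y : V3, y ∉ sphere (0:V3) R := by
      rw [← measure_eq_zero_iff_ae_notMem]
      exact Measure.addHaar_sphere _ _ _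
    filter_upwards [this] with y hy hy2
    simp only [mem_sphere, mem_closedBall, mem_ball] at *
    exact lt_of_le_of_ne hy2 hy
  filter_upwards [hsph] with y hy
  have hy' := ball_subset_closedBall hy
  apply intervalIntegral.integral_eq_sub_of_hasDeriv_right
  · exact hf.comp (by fun_prop) (fun s hs => ⟨hsub hs, hy'⟩)
  · intro s hs
    refine (hd s ⟨?_, ?_⟩ y hy).hasDerivWithinAt
    · exact lt_of_le_of_lt (le_min ha.1 hb.1) hs.1
    · exact lt_of_lt_of_le hs.2 (max_le ha.2 hb.2)
  · apply ContinuousOn.intervalIntegrable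
    exact hg.comp (by fun_prop) (fun s hs => ⟨hsub hs, hy'⟩)

lemma shift_ball (c : V3) (R : ℝ) (h : V3 → ℝ) :
    ∫ x in closedBall c R, h x = ∫ y in closedBall (0:V3) R, h (c + y) := by
  rw [← (measurePreserving_add_left volume c).setIntegral_preimage_emb
    (measurableEmbedding_addLeft c)]
  congr 2
  ext y
  simp

/-- Total flux identity. -/
lemma flux_aux (Tm Tp R : ℝ) (hR : 0 < R) (f : ℝ × V3 → ℝ) (F : Fin 3 → ℝ × V3 → ℝ)
    (hlt : Tm < Tp)
    (hf : ContDiffOn ℝ 1 f (Set.Icc Tm Tp ×ˢ closedBall (0:V3) R))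
    (hF : ∀ i, ContDiffOn ℝ 1 (F i) (Set.Icc Tm Tp ×ˢ closedBall (0:V3) R))
    (hd : ∀ p ∈ Set.Ioo Tm Tp ×ˢ ball (0:V3) R, ∃ (D : ℝ) (E : Fin 3 → ℝ),
      HasDerivAt (fun s => f (s, p.2)) D p.1 ∧
      (∀ i, HasLineDerivAt ℝ (fun y => F i (p.1, y)) (E i) p.2 (EuclideanSpace.single i 1)) ∧
      D = ∑ i, E i)
    (a b : ℝ) (ha : a ∈ Set.Icc Tm Tp) (hb : b ∈ Set.Icc Tm Tp) :
    ∫ s in a..b, R ^ 2 * ∫ ω : S2, ∑ i, F i (s, R • (ω : V3)) * (ω : V3) i ∂σ2 =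
      (∫ y in closedBall (0:V3) R, f (b, y)) - ∫ y in closedBall (0:V3) R, f (a, y) := by
  set K := Set.Icc Tm Tp ×ˢ closedBall (0:V3) R with hK
  have hconv : Convex ℝ (closedBall (0:V3) R) := convex_closedBall _ _
  have hU : UniqueDiffOn ℝ K := (uniqueDiffOn_Icc hlt).prod
    (uniqueDiffOn_convex hconv (by rw [interior_closedBall _ hR.ne']; exact ⟨0, by simpa using hR⟩))
  have hnh : ∀ p ∈ Set.Ioo Tm Tp ×ˢ ball (0:V3) R, K ∈ 𝓝 p := fun p hp =>
    prod_mem_nhds (Icc_mem_nhds hp.1.1 hp.1.2) (closedBall_mem_nhds_of_mem hp.2)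
  have hcont : ∀ g : ℝ × V3 → ℝ, ContDiffOn ℝ 1 g K → ∀ w,
      ContinuousOn (fun p => fderivWithin ℝ g K p w) K := fun g hg w =>
    (hg.continuousOn_fderivWithin hU le_rfl).clm_apply continuousOn_const
  have hfd : ∀ g : ℝ × V3 → ℝ, ContDiffOn ℝ 1 g K → ∀ p ∈ Set.Ioo Tm Tp ×ˢ ball (0:V3) R,
      HasFDerivAt g (fderivWithin ℝ g K p) p := fun g hg p hp =>
    ((hg.differentiableOn (by simp)) p (mem_of_mem_nhds (hnh p hp))).hasFDerivWithinAt.hasFDerivAt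
      (hnh p hp)
  have hfd1 : ∀ g : ℝ × V3 → ℝ, ContDiffOn ℝ 1 g K → ∀ p ∈ Set.Ioo Tm Tp ×ˢ ball (0:V3) R,
      HasDerivAt (fun s => g (s, p.2)) (fderivWithin ℝ g K p (1, 0)) p.1 := by
    intro g hg p hp
    have h := hfd g hg p hp
    have h2 : HasDerivAt (fun s : ℝ => (s, p.2)) ((1:ℝ), (0:V3)) p.1 :=
      (hasDerivAt_id p.1).prodMk (hasDerivAt_const p.1 p.2)
    exact HasFDerivAt.comp_hasDerivAt (l := g) p.1 h h2
  have hfd2 : ∀ g : ℝ × V3 → ℝ, ContDiffOn ℝ 1 g K → ∀ p ∈ Set.Ioo Tm Tp ×ˢ ball (0:V3) R,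
      ∀ w, HasLineDerivAt ℝ (fun y => g (p.1, y)) (fderivWithin ℝ g K p (0, w)) p.2 w := by
    intro g hg p hp w
    have h := hfd g hg p hp
    have h2 : HasFDerivAt (fun y : V3 => (p.1, y)) (ContinuousLinearMap.inr ℝ ℝ V3) p.2 :=
      hasFDerivAt_prodMk_right p.1 p.2
    have h3 : HasFDerivAt (fun y => g (p.1, y)) _ p.2 := HasFDerivAt.comp (g := g) p.2 h h2
    simpa using h3.hasLineDerivAt w
  rw [← time_ftc Tm Tp R f (fun p => fderivWithin ℝ f K p (1, 0)) hf.continuousOn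
    (hcont f hf _) (fun s hs y hy => hfd1 f hf (s, y) ⟨hs, hy⟩) a b ha hb hR]
  apply intervalIntegral.integral_congr_ae
  have hne : ∀ᵐ s : ℝ, s ∈ ({Tm, Tp} : Set ℝ)ᶜ := by
    exact (Set.Finite.countable (by simp)).ae_notMem volume
  filter_upwards [hne] with s hs hsab
  have hs1 : s ∈ Set.Icc Tm Tp := Set.uIcc_subset_Icc ha hb (Set.uIoc_subset_uIcc hsab)
  have hs2 : s ∈ Set.Ioo Tm Tp := by
    simp only [Set.mem_compl_iff, Set.mem_insert_iff, Set.mem_singleton_iff, not_or] at hs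
    exact ⟨lt_of_le_of_ne hs1.1 (Ne.symm hs.1), lt_of_le_of_ne hs1.2 hs.2⟩
  have hsl : ∀ g : ℝ × V3 → ℝ, ContinuousOn g K →
      ContinuousOn (fun y => g (s, y)) (closedBall (0:V3) R) := fun g hg =>
    hg.comp (by fun_prop) (fun y hy => ⟨hs1, hy⟩)
  have hsph : ∀ᵐ y ∂(volume.restrict (closedBall (0:V3) R)), y ∈ ball (0:V3) R := by
    rw [ae_restrict_iff' measurableSet_closedBall]
    have : ∀ᵐ y : V3, y ∉ sphere (0:V3) R := by
      rw [← measure_eq_zero_iff_ae_notMem]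
      exact Measure.addHaar_sphere _ _ _
    filter_upwards [this] with y hy hy2
    simp only [mem_sphere, mem_closedBall, mem_ball] at *
    exact lt_of_le_of_ne hy2 hy
  have e1 : ∫ y in closedBall (0:V3) R, fderivWithin ℝ f K (s, y) (1, 0) =
      ∫ y in closedBall (0:V3) R, ∑ i, fderivWithin ℝ (F i) K (s, y) (0, EuclideanSpace.single i 1) := by
    apply integral_congr_ae
    filter_upwards [hsph] with y hy
    obtain ⟨D, E, h1, h2, h3⟩ := hd (s, y) ⟨hs2, hy⟩
    rw [(hfd1 f hf (s, y) ⟨hs2, hy⟩).unique h1, h3]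
    apply Finset.sum_congr rfl
    intro i _
    exact (h2 i).unique (hfd2 (F i) (hF i) (s, y) ⟨hs2, hy⟩ _)
  have e2 : ∫ y in closedBall (0:V3) R, ∑ i,
      fderivWithin ℝ (F i) K (s, y) (0, EuclideanSpace.single i 1) =
      ∑ i, ∫ y in closedBall (0:V3) R,
        fderivWithin ℝ (F i) K (s, y) (0, EuclideanSpace.single i 1) := by
    apply integral_finsetSum
    intro i _
    have h1 : ContinuousOn (fun y : V3 => fderivWithin ℝ (F i) K (s, y)
        (0, EuclideanSpace.single i 1)) (closedBall (0:V3) R) := hsl _ (hcont (F i) (hF i) _)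
    exact h1.integrableOn_compact (isCompact_closedBall _ _)
  have e3 : ∫ ω : S2, ∑ i, F i (s, R • (ω : V3)) * (ω : V3) i ∂σ2 =
      ∑ i, ∫ ω : S2, F i (s, R • (ω : V3)) * (ω : V3) i ∂σ2 := by
    apply integral_finsetSum
    intro i _
    have h1 : Continuous (fun ω : S2 => F i (s, R • (ω : V3))) := by
      rw [← continuousOn_univ]
      exact (hsl _ (hF i).continuousOn).comp (f := fun ω : S2 => R • (ω : V3)) (by fun_prop)
        (fun ω _ => by simp [norm_smul, abs_of_pos hR])
    have h2 : Continuous (fun ω : S2 => F i (s, R • (ω : V3)) * (ω : V3) i) :=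
      h1.mul (by fun_prop)
    exact h2.integrable_of_hasCompactSupport (HasCompactSupport.of_compactSpace _)
  rw [e1, e2, e3, Finset.mul_sum]
  apply Finset.sum_congr rfl
  intro i _
  rw [grad_ball R hR (EuclideanSpace.single i 1) (fun y => F i (s, y)) _
    (hsl _ (hF i).continuousOn) (hsl _ (hcont (F i) (hF i) _))
    (fun y hy => hfd2 (F i) (hF i) (s, y) ⟨hs2, hy⟩ _)]
  simp [EuclideanSpace.inner_single_right]

lemma flux (Tm Tp t₀ t R : ℝ) (hlt : Tm < Tp) (ht₀ : t₀ ∈ Set.Icc Tm Tp)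
    (ht : t ∈ Set.Icc Tm Tp) (hR : 0 < R)
    (rhat : ℝ → V3) (hr : ContDiff ℝ 2 rhat) (ρ : ℝ × V3 → ℝ) (J : ℝ × V3 → Fin 3 → ℝ)
    (hρ : ContDiffOn ℝ 1 ρ (Tube Tm Tp rhat R))
    (hJ : ContDiffOn ℝ 1 J (Tube Tm Tp rhat R))
    (hcont : ∀ p ∈ Tube Tm Tp rhat R,
      ptD ρ p + ∑ i, pxD i (fun p' => J p' i) p = 0)
    (κ : ℝ) (hκ : ∀ (c : V3) (R : ℝ), 0 < R → ∀ h : V3 → ℝ,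
      ∫ x in sphere c R, h x ∂μH[2] = κ * (R ^ 2 * ∫ ω : S2, h (c + R • (ω : V3)) ∂σ2)) :
    ∫ t' in t₀..t, ∫ x in sphere (rhat t') R,
        (ρ (t', x) * dot3 (fun i => deriv rhat t' i) (nrm (rhat t') R x)
          - dot3 (nrm (rhat t') R x) (J (t', x))) ∂μH[2] =
    κ * ((∫ x in closedBall (rhat t) R, ρ (t, x)) - ∫ x in closedBall (rhat t₀) R, ρ (t₀, x)) := by
  have hr1 : ContDiff ℝ 1 rhat := hr.of_le (by norm_num)
  have hdr : ContDiff ℝ 1 (deriv rhat) := ((contDiff_succ_iff_deriv (n := 1)).1 hr).2.2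
  set Φ : ℝ × V3 → ℝ × V3 := fun p => (p.1, rhat p.1 + p.2) with hΦ
  have hΦd : ContDiff ℝ 1 Φ := by
    apply contDiff_fst.prodMk
    exact (hr1.comp contDiff_fst).add contDiff_snd
  have hmaps : Set.MapsTo Φ (Set.Icc Tm Tp ×ˢ closedBall (0:V3) R) (Tube Tm Tp rhat R) := by
    rintro ⟨s, y⟩ ⟨hs, hy⟩
    refine ⟨hs, ?_⟩
    simpa [hΦ] using hy
  set F : Fin 3 → ℝ × V3 → ℝ := fun i p => deriv rhat p.1 i * ρ (Φ p) - J (Φ p) i with hFdef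
  have hf : ContDiffOn ℝ 1 (ρ ∘ Φ) (Set.Icc Tm Tp ×ˢ closedBall (0:V3) R) :=
    hρ.comp hΦd.contDiffOn hmaps
  have hJi : ∀ i, ContDiffOn ℝ 1 (fun p => J p i) (Tube Tm Tp rhat R) := fun i =>
    contDiffOn_pi.1 hJ i
  have hvi : ∀ i, ContDiff ℝ 1 (fun p : ℝ × V3 => deriv rhat p.1 i) := fun i => by
    have h1 : ContDiff ℝ 1 (fun p : ℝ × V3 => deriv rhat p.1) := hdr.comp contDiff_fst
    exact (contDiff_euclidean.1 h1) i
  have hF : ∀ i, ContDiffOn ℝ 1 (F i) (Set.Icc Tm Tp ×ˢ closedBall (0:V3) R) := fun i =>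
    ((hvi i).contDiffOn.mul hf).sub ((hJi i).comp hΦd.contDiffOn hmaps)
  have hopen : ∀ p ∈ Set.Ioo Tm Tp ×ˢ ball (0:V3) R, Tube Tm Tp rhat R ∈ 𝓝 (Φ p) := by
    intro p hp
    have h1 : {q : ℝ × V3 | q.1 ∈ Set.Ioo Tm Tp ∧ ‖q.2 - rhat q.1‖ < R} ∈ 𝓝 (Φ p) := by
      apply IsOpen.mem_nhds
      · apply (isOpen_Ioo.preimage continuous_fst).inter
        exact isOpen_lt (continuous_snd.sub (hr1.continuous.comp continuous_fst)).norm
          continuous_const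
      · refine ⟨hp.1, ?_⟩
        simpa [hΦ] using hp.2
    filter_upwards [h1] with q hq
    exact ⟨⟨hq.1.1.le, hq.1.2.le⟩, hq.2.le⟩
  have hflux := flux_aux Tm Tp R hR (ρ ∘ Φ) F hlt hf hF (by
    rintro ⟨s, y⟩ hp
    have hn := hopen _ hp
    have hρd : HasFDerivAt ρ (fderiv ℝ ρ (Φ (s, y))) (Φ (s, y)) :=
      ((hρ.contDiffAt hn).differentiableAt (by simp)).hasFDerivAt
    have hJd : ∀ i, HasFDerivAt (fun p => J p i) (fderiv ℝ (fun p => J p i) (Φ (s, y)))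
        (Φ (s, y)) := fun i =>
      (((hJi i).contDiffAt hn).differentiableAt (by simp)).hasFDerivAt
    refine ⟨fderiv ℝ ρ (Φ (s, y)) (1, deriv rhat s), fun i =>
      deriv rhat s i * pxD i ρ (Φ (s, y)) - pxD i (fun p => J p i) (Φ (s, y)), ?_, ?_, ?_⟩
    · have h2 : HasDerivAt (fun s : ℝ => Φ (s, y)) ((1:ℝ), deriv rhat s) s :=
        (hasDerivAt_id s).prodMk
          (((hr1.differentiable (by simp)) s).hasDerivAt.add_const y)
      exact HasFDerivAt.comp_hasDerivAt (l := ρ) s hρd h2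
    · intro i
      have h2 : HasFDerivAt (fun y : V3 => Φ (s, y)) (ContinuousLinearMap.inr ℝ ℝ V3) y :=
        (hasFDerivAt_const s y).prodMk ((hasFDerivAt_id y).const_add (rhat s))
      have h3 : HasFDerivAt (fun y => ρ (Φ (s, y))) _ y := HasFDerivAt.comp (g := ρ) y hρd h2
      have h4 : HasFDerivAt (fun y => J (Φ (s, y)) i) _ y :=
        HasFDerivAt.comp (g := fun p => J p i) y (hJd i) h2
      have h5 := ((h3.const_mul (deriv rhat s i)).sub h4).hasLineDerivAt
        (EuclideanSpace.single i 1)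
      simp only [ContinuousLinearMap.sub_apply, ContinuousLinearMap.smul_apply,
        ContinuousLinearMap.comp_apply, ContinuousLinearMap.inr_apply, smul_eq_mul] at h5
      exact h5
    · have hc := hcont (Φ (s, y)) (mem_of_mem_nhds hn)
      have hv : ((1:ℝ), deriv rhat s) = ((1:ℝ), (0:V3)) +
          ∑ i, deriv rhat s i • ((0:ℝ), (EuclideanSpace.single i (1:ℝ) : V3)) := by
        ext i
        · simp [Fin.sum_univ_three]
        · fin_cases i <;> simp [Fin.sum_univ_three]
      rw [hv, map_add, map_sum]
      simp only [map_smul, smul_eq_mul, Finset.sum_sub_distrib]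
      simp only [pxD, ptD] at hc ⊢
      linarith) t₀ t ht₀ ht
  rw [shift_ball (rhat t), shift_ball (rhat t₀)]
  have e : (∫ y in closedBall (0:V3) R, ρ (t, rhat t + y)) -
      ∫ y in closedBall (0:V3) R, ρ (t₀, rhat t₀ + y) =
      ∫ s in t₀..t, R ^ 2 * ∫ ω : S2, ∑ i, F i (s, R • (ω : V3)) * (ω : V3) i ∂σ2 := hflux.symm
  rw [e, ← intervalIntegral.integral_const_mul]
  apply intervalIntegral.integral_congr
  intro s _
  simp only
  rw [hκ _ R hR]
  congr 3
  ext ω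
  have hnr : ∀ i, nrm (rhat s) R (rhat s + R • (ω : V3)) i = (ω : V3) i := by
    intro i
    simp [nrm, hR.ne']
  simp only [dot3, hnr, hFdef, hΦ, Fin.sum_univ_three]
  ring

/-- If `C¹` densities `ρ_n`, `J_n` on the shrinking tubes around the
trajectory `r̂` satisfy the continuity equation, the boundary terms `Q₂₃` vanish
uniformly, and `ρ̄_n(t₀) → ρ̄_∞`, then `ρ̄_n(t) → ρ̄_∞` uniformly on `[T₋,T₊]`. -/
theorem statement3
    (Tm Tp t₀ : ℝ) (ht₀ : t₀ ∈ Set.Icc Tm Tp)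
    (rhat : ℝ → V3) (htraj : IsTrajectory Tm Tp rhat)
    (R : ℕ → ℝ) (hRpos : ∀ n, 0 < R n) (hR0 : Tendsto R atTop (nhds 0))
    (ρ : ℕ → ℝ × V3 → ℝ) (J : ℕ → ℝ × V3 → Fin 3 → ℝ)
    (hρ : ∀ n, ContDiffOn ℝ 1 (ρ n) (Tube Tm Tp rhat (R n)))
    (hJ : ∀ n, ContDiffOn ℝ 1 (J n) (Tube Tm Tp rhat (R n)))
    (hcont : ∀ n, ∀ p ∈ Tube Tm Tp rhat (R n),
      ptD (ρ n) p + ∑ i, pxD i (fun p' => J n p' i) p = 0)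
    (ρinf : ℝ)
    (hconv : Tendsto (fun n => ∫ x in closedBall (rhat t₀) (R n), ρ n (t₀, x))
      atTop (nhds ρinf))
    (hQ23 : TendstoUniformlyOn
      (fun n t => ∫ t' in t₀..t, ∫ x in sphere (rhat t') (R n),
        (ρ n (t', x) * dot3 (fun i => deriv rhat t' i) (nrm (rhat t') (R n) x)
          - dot3 (nrm (rhat t') (R n) x) (J n (t', x))) ∂μH[2])
      (fun _ => 0) atTop (Set.Icc Tm Tp)) :
    TendstoUniformlyOn
      (fun n t => ∫ x in closedBall (rhat t) (R n), ρ n (t, x))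
      (fun _ => ρinf) atTop (Set.Icc Tm Tp) := by
  obtain ⟨κ, hκ0, hκ⟩ := haus_sphere
  rw [Metric.tendstoUniformlyOn_iff] at hQ23 ⊢
  intro ε hε
  have h1 := hQ23 (κ * (ε / 2)) (by positivity)
  have h2 := (Metric.tendsto_nhds.1 hconv) (ε / 2) (by positivity)
  filter_upwards [h1, h2] with n hn1 hn2 t ht
  rcases (ht₀.1.trans ht₀.2).eq_or_lt with heq | hlt
  · have : t = t₀ := by
      rw [← heq, Set.Icc_self] at ht ht₀
      exact ht.trans ht₀.symm
    rw [this, dist_comm]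
    linarith
  · have hfl := flux Tm Tp t₀ t (R n) hlt ht₀ ht (hRpos n) rhat htraj.1 (ρ n) (J n) (hρ n) (hJ n)
      (hcont n) κ hκ
    have h3 := hn1 t ht
    simp only at h3
    rw [hfl, dist_comm, Real.dist_eq, sub_zero, abs_mul, abs_of_pos hκ0] at h3
    have h4 := lt_of_mul_lt_mul_left h3 hκ0.le
    rw [Real.dist_eq] at hn2 ⊢
    rw [abs_lt] at h4 hn2 ⊢
    constructor <;> linarith [h4.1, h4.2, hn2.1, hn2.2]

end
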